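/- arXiv:math/0311358 — 13 statements merged into one kernel-verified Lean document; each statement's English description precedes it below -/
import Mathlib

section
/- Let n ≥ 4 be an integer. Let P_n be the set of subsets T ⊆ {1,…,n} with 1 ∈ T and 2 ≤ |T| ≤ n−2, and let V be the real vector space of functions P_n → ℝ with standard basis (e_T)_{T ∈ P_n}. For 3 ≤ i < j ≤ n define R_{ij} := Σ_{T ∈ P_n, 2∈T, i∉T, j∉T} e_T − Σ_{T ∈ P_n, i∈T, 2∉T, j∉T} e_T, and for 4 ≤ k ≤ n define S_k := Σ_{T ∈ P_n, 3∈T, 2∉T, k∉T} e_T − Σ_{T ∈ P_n, k∈T, 2∉T, 3∉T} e_T. Then the family consisting of all R_{ij} (3 ≤ i < j ≤ n) together with all S_k (4 ≤ k ≤ n), which has C(n,2) − n members in total, is linearly independent over ℝ. -/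
/-- The index set `P_n`: subsets `T ⊆ {1,…,n}` with `1 ∈ T` and `2 ≤ |T| ≤ n−2`. -/
def KeelIndex (n : ℕ) : Type :=
  {T : Finset ℕ // T ⊆ Finset.Icc 1 n ∧ 1 ∈ T ∧ 2 ≤ T.card ∧ T.card ≤ n - 2}

/-- The relation vector `R_{ij} = Σ_{2∈T, i∉T, j∉T} e_T − Σ_{i∈T, 2∉T, j∉T} e_T`
as a function `P_n → ℝ`. -/
def KeelR (n i j : ℕ) : KeelIndex n → ℝ := fun T =>
  (if 2 ∈ T.val ∧ i ∉ T.val ∧ j ∉ T.val then (1 : ℝ) else 0)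
    - (if i ∈ T.val ∧ 2 ∉ T.val ∧ j ∉ T.val then (1 : ℝ) else 0)

/-- The relation vector `S_k = Σ_{3∈T, 2∉T, k∉T} e_T − Σ_{k∈T, 2∉T, 3∉T} e_T`
as a function `P_n → ℝ`. -/
def KeelS (n k : ℕ) : KeelIndex n → ℝ := fun T =>
  (if 3 ∈ T.val ∧ 2 ∉ T.val ∧ k ∉ T.val then (1 : ℝ) else 0)
    - (if k ∈ T.val ∧ 2 ∉ T.val ∧ 3 ∉ T.val then (1 : ℝ) else 0)

/-- The number of pairs `3 ≤ i < j ≤ m + 2` is `m.choose 2`. -/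
theorem natCard_pairs_from_three (m : ℕ) :
    Nat.card {p : ℕ × ℕ // 3 ≤ p.1 ∧ p.1 < p.2 ∧ p.2 ≤ m + 2} = m.choose 2 := by
  have e : {p : ℕ × ℕ // 3 ≤ p.1 ∧ p.1 < p.2 ∧ p.2 ≤ m + 2} ≃
      ((Finset.range (m + 3)).sigma fun j => Finset.Ico 3 j) :=
    { toFun := fun p => ⟨⟨p.1.2, p.1.1⟩, by
        have := p.2
        simp only [Finset.mem_sigma, Finset.mem_range, Finset.mem_Ico]; omega⟩
      invFun := fun q => ⟨(q.1.2, q.1.1), by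
        have := q.2
        simp only [Finset.mem_sigma, Finset.mem_range, Finset.mem_Ico] at this; omega⟩
      left_inv := fun _ => rfl
      right_inv := fun _ => rfl }
  rw [Nat.card_congr e, Nat.card_eq_fintype_card, Fintype.card_coe, Finset.card_sigma]
  simp only [Nat.card_Ico]
  clear e
  induction m with
  | zero => rfl
  | succ m ih =>
    rw [show m + 1 + 3 = m + 3 + 1 by ring, Finset.sum_range_succ, ih,
      Nat.choose_succ_succ' m 1, Nat.choose_one_right, Nat.add_sub_cancel, add_comm]

/-- The index `{1,…,n} \ {i, j}`. -/
def KeelIndex.compl (n i j : ℕ) (hi : 3 ≤ i) (hij : i < j) (hj : j ≤ n) : KeelIndex n :=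
  ⟨Finset.Icc 1 n \ {i, j}, Finset.sdiff_subset, by simp; omega, by
    have h : ({i, j} : Finset ℕ) ⊆ Finset.Icc 1 n := by
      intro x
      simp only [Finset.mem_insert, Finset.mem_singleton, Finset.mem_Icc]
      omega
    rw [Finset.card_sdiff_of_subset h, Finset.card_pair hij.ne, Nat.card_Icc]
    omega⟩

/-- The index `{1, k}`. -/
def KeelIndex.pair (n k : ℕ) (hk : 4 ≤ k) (hkn : k ≤ n) : KeelIndex n :=
  ⟨{1, k}, by
    intro x
    simp only [Finset.mem_insert, Finset.mem_singleton, Finset.mem_Icc]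
    omega, by simp, by rw [Finset.card_pair (by omega)]; omega⟩

theorem KeelR_compl {n i j a b : ℕ} (hi : 3 ≤ i) (hij : i < j) (hj : j ≤ n)
    (ha : 3 ≤ a) (hab : a < b) (hb : b ≤ n) :
    KeelR n a b (.compl n i j hi hij hj) = if a = i ∧ b = j then 1 else 0 := by
  simp only [KeelR, KeelIndex.compl, Finset.mem_sdiff, Finset.mem_Icc, Finset.mem_insert,
    Finset.mem_singleton]
  split_ifs <;> first | omega | norm_num

theorem KeelS_compl {n i j : ℕ} (hi : 3 ≤ i) (hij : i < j) (hj : j ≤ n) (k : ℕ) :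
    KeelS n k (.compl n i j hi hij hj) = 0 := by
  have h : 2 ∈ (KeelIndex.compl n i j hi hij hj).val := by
    simp only [KeelIndex.compl, Finset.mem_sdiff, Finset.mem_Icc, Finset.mem_insert,
      Finset.mem_singleton]
    omega
  simp [KeelS, h]

theorem KeelS_pair {n k l : ℕ} (hk : 4 ≤ k) (hkn : k ≤ n) (hl : 4 ≤ l) :
    KeelS n l (.pair n k hk hkn) = if l = k then -1 else 0 := by
  simp only [KeelS, KeelIndex.pair, Finset.mem_insert, Finset.mem_singleton]
  rw [if_neg (by omega)]
  split_ifs <;> first | omega | norm_num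

/-- For `n ≥ 4`, the family of all `R_{ij}` (`3 ≤ i < j ≤ n`) together
with all `S_k` (`4 ≤ k ≤ n`), which has `C(n,2) − n` members in total, is linearly
independent over `ℝ` in the space of functions `P_n → ℝ`. -/
theorem keel_relations_linearIndependent (n : ℕ) (hn : 4 ≤ n) :
    Nat.card ({p : ℕ × ℕ // 3 ≤ p.1 ∧ p.1 < p.2 ∧ p.2 ≤ n} ⊕
        {k : ℕ // 4 ≤ k ∧ k ≤ n}) = n.choose 2 - n ∧
    LinearIndependent ℝ
      (Sum.elim (fun p : {p : ℕ × ℕ // 3 ≤ p.1 ∧ p.1 < p.2 ∧ p.2 ≤ n} =>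
          KeelR n p.val.1 p.val.2)
        (fun k : {k : ℕ // 4 ≤ k ∧ k ≤ n} => KeelS n k.val)) := by
  constructor
  · have : Finite {p : ℕ × ℕ // 3 ≤ p.1 ∧ p.1 < p.2 ∧ p.2 ≤ n} :=
      Set.Finite.to_subtype (s := {p : ℕ × ℕ | 3 ≤ p.1 ∧ p.1 < p.2 ∧ p.2 ≤ n})
        ((Set.finite_Iic (n, n)).subset fun p hp => ⟨by have := hp.2; omega, hp.2.2⟩)
    have : Finite {k : ℕ // 4 ≤ k ∧ k ≤ n} := (Set.finite_Icc 4 n).to_subtype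
    have hS : Nat.card {k : ℕ // 4 ≤ k ∧ k ≤ n} = n + 1 - 4 := by
      rw [← Nat.card_Icc, ← Set.ncard_coe_finset, Finset.coe_Icc]
      exact Nat.card_coe_set_eq (Set.Icc 4 n)
    obtain ⟨m, rfl⟩ : ∃ m, n = m + 2 := ⟨n - 2, by omega⟩
    rw [Nat.card_sum, hS, natCard_pairs_from_three, Nat.choose_succ_succ' (m + 1) 1,
      Nat.choose_succ_succ' m 1, Nat.choose_one_right, Nat.choose_one_right, one_add_one_eq_two]
    omega
  · rw [linearIndependent_iff']
    intro s g h
    have hR : ∀ p, Sum.inl p ∈ s → g (Sum.inl p) = 0 := by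
      rintro ⟨⟨i, j⟩, hi, hij, hj⟩ hp
      have hT := congrFun h (.compl n i j hi hij hj)
      rw [Finset.sum_apply, Finset.sum_eq_single_of_mem _ hp] at hT
      · simpa [KeelR_compl hi hij hj hi hij hj] using hT
      · rintro (⟨⟨a, b⟩, ha, hab, hb⟩ | k) _ hne
        · have hne' : ¬ (a = i ∧ b = j) := by
            rintro ⟨rfl, rfl⟩
            exact hne rfl
          simp [KeelR_compl hi hij hj ha hab hb, hne']
        · simp [KeelS_compl]
    rintro (p | ⟨k, hk, hkn⟩) hp
    · exact hR p hp
    · have hT := congrFun h (.pair n k hk hkn)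
      rw [Finset.sum_apply, Finset.sum_eq_single_of_mem _ hp] at hT
      · simpa [KeelS_pair hk hkn hk] using hT
      · rintro (p | ⟨l, hl, hln⟩) hq hne
        · simp [hR p hq]
        · have hne' : l ≠ k := by
            rintro rfl
            exact hne rfl
          simp [KeelS_pair hk hkn hl, hne']
end

section
/- Let n ≥ 5 be an integer and let x_2, …, x_{n−2} be real numbers such that m·x_{n−m+1} ≥ (m−2)·x_{n−m} for every integer m with 3 ≤ m ≤ n−2. Then for all integers l and k with 3 ≤ l ≤ n−2 and 1 ≤ k ≤ l−2 one has l(l−1)·x_{n−l+k} ≥ (l−k−1)(l−k)·x_{n−l}. -/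
/-- the inequalities `m·x_{n−m+1} ≥ (m−2)·x_{n−m}` (`3 ≤ m ≤ n−2`)
generate the full family `l(l−1)·x_{n−l+k} ≥ (l−k−1)(l−k)·x_{n−l}`
(`3 ≤ l ≤ n−2`, `1 ≤ k ≤ l−2`). -/
theorem QnContrib_generates (n : ℕ) (hn : 5 ≤ n) (x : ℕ → ℝ)
    (h : ∀ m : ℕ, 3 ≤ m → m ≤ n - 2 →
      (m : ℝ) * x (n - m + 1) ≥ ((m : ℝ) - 2) * x (n - m)) :
    ∀ l k : ℕ, 3 ≤ l → l ≤ n - 2 → 1 ≤ k → k ≤ l - 2 →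
      (l : ℝ) * ((l : ℝ) - 1) * x (n - l + k)
        ≥ ((l : ℝ) - k - 1) * ((l : ℝ) - k) * x (n - l) := by
  intro l k hl hln _ hkl
  clear * - h hl hln hkl
  induction k with
  | zero => simp [mul_comm]
  | succ k ih =>
    have hk := ih (by omega)
    have hm := h (l - k) (by omega) (by omega)
    rw [show n - (l - k) + 1 = n - l + (k + 1) by omega,
      show n - (l - k) = n - l + k by omega, Nat.cast_sub (by omega)] at hm
    have hlk : (k : ℝ) + 3 ≤ l := by exact_mod_cast (by omega : k + 3 ≤ l)
    have hl' : (3 : ℝ) ≤ l := by exact_mod_cast hl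
    have h₁ := mul_le_mul_of_nonneg_left hm
      (mul_nonneg (by linarith) (by linarith) : 0 ≤ (l : ℝ) * ((l : ℝ) - 1))
    have h₂ := mul_le_mul_of_nonneg_left hk (by linarith : 0 ≤ (l : ℝ) - k - 2)
    push_cast
    refine le_of_mul_le_mul_left ?_ (by linarith : 0 < (l : ℝ) - k)
    linarith
end

section
/- Let n ≥ 6 be an integer and set d := ⌊n/2⌋. For each function s : {3,…,d} → {0,1} define a vector v_s ∈ ℝ^{d−1}, with coordinates indexed by 2,…,d, by v_s(2) := 1 and, for 2 ≤ i ≤ d−1, v_s(i+1) := v_s(i)·((n−i−2)/(n−i)) if s(i+1) = 0 and v_s(i+1) := v_s(i)·((i+1)/(i−1)) if s(i+1) = 1. Then the set of all (x_2,…,x_d) ∈ ℝ^{d−1} satisfying ((n−i−2)/(n−i))·x_i ≤ x_{i+1} ≤ ((i+1)/(i−1))·x_i for all 2 ≤ i ≤ d−1 is exactly the set of nonnegative linear combinations of the 2^{d−2} vectors v_s. -/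
/-- The inductively-defined generating vector `v_s` of `Nem(X_{n,0})`, where the
choice function `s : {3,…,d} → {0,1}` is encoded as the set `s ⊆ {3,…,d}` of
indices where the value is `1`:  `v_s(2) = 1`, and
`v_s(i+1) = v_s(i)·((i+1)/(i−1))` if `i+1 ∈ s`, else `v_s(i+1) = v_s(i)·((n−i−2)/(n−i))`. -/
noncomputable def nemGen (n : ℕ) (s : Finset ℕ) : ℕ → ℝ
  | 0 => 0
  | 1 => 0
  | 2 => 1
  | (i + 3) => nemGen n s (i + 2) *
      (if (i + 3) ∈ s then ((i : ℝ) + 3) / ((i : ℝ) + 1)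
       else ((n : ℝ) - (i : ℝ) - 4) / ((n : ℝ) - (i : ℝ) - 2))

theorem nemGen_succ (n : ℕ) (s : Finset ℕ) {i : ℕ} (hi : 2 ≤ i) :
    nemGen n s (i + 1) = nemGen n s i *
      (if i + 1 ∈ s then ((i : ℝ) + 1) / ((i : ℝ) - 1)
       else ((n : ℝ) - i - 2) / ((n : ℝ) - i)) := by
  obtain ⟨k, rfl⟩ := Nat.exists_eq_add_of_le' hi
  rw [nemGen]
  push_cast
  congr 3 <;> ring

theorem nemGen_congr (n : ℕ) {s t : Finset ℕ} {i : ℕ} (hi : 2 ≤ i)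
    (h : ∀ j ≤ i, j ∈ s ↔ j ∈ t) : nemGen n s i = nemGen n t i := by
  induction i, hi using Nat.le_induction with
  | base => rfl
  | succ m hm ih =>
    rw [nemGen_succ n s hm, nemGen_succ n t hm, ih fun j hj => h j (by omega)]
    simp only [h (m + 1) le_rfl]

theorem nem_lower_slope_nonneg {n i : ℕ} (hin : i + 2 ≤ n) :
    0 ≤ ((n : ℝ) - i - 2) / ((n : ℝ) - i) := by
  have h : (i : ℝ) + 2 ≤ n := by exact_mod_cast hin
  exact div_nonneg (by linarith) (by linarith)

theorem nem_lower_slope_lt_upper_slope {n i : ℕ} (hi : 2 ≤ i) (hin : i + 2 ≤ n) :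
    ((n : ℝ) - i - 2) / ((n : ℝ) - i) < ((i : ℝ) + 1) / ((i : ℝ) - 1) := by
  have h : (i : ℝ) + 2 ≤ n := by exact_mod_cast hin
  have h2 : (2 : ℝ) ≤ i := by exact_mod_cast hi
  calc ((n : ℝ) - i - 2) / ((n : ℝ) - i) < 1 := by
        rw [div_lt_one (by linarith)]; linarith
    _ < ((i : ℝ) + 1) / ((i : ℝ) - 1) := by
        rw [one_lt_div (by linarith)]; linarith

theorem nemGen_nonneg {n : ℕ} (s : Finset ℕ) {i : ℕ} (hi : 2 ≤ i) (hin : i + 1 ≤ n) :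
    0 ≤ nemGen n s i := by
  induction i, hi using Nat.le_induction with
  | base => exact zero_le_one
  | succ m hm ih =>
    have hlo := nem_lower_slope_nonneg (n := n) (i := m) (by omega)
    have hlt := nem_lower_slope_lt_upper_slope (n := n) hm (by omega)
    rw [nemGen_succ n s hm]
    refine mul_nonneg (ih (by omega)) ?_
    split_ifs
    · exact hlo.trans hlt.le
    · exact hlo

theorem nemGen_slope_bounds {n : ℕ} (s : Finset ℕ) {i : ℕ} (hi : 2 ≤ i) (hin : i + 2 ≤ n) :
    (((n : ℝ) - i - 2) / ((n : ℝ) - i)) * nemGen n s i ≤ nemGen n s (i + 1) ∧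
      nemGen n s (i + 1) ≤ (((i : ℝ) + 1) / ((i : ℝ) - 1)) * nemGen n s i := by
  have h0 := nemGen_nonneg (n := n) s hi (by omega)
  have hlt := nem_lower_slope_lt_upper_slope hi hin
  rw [nemGen_succ n s hi, mul_comm (nemGen n s i)]
  constructor <;> refine mul_le_mul_of_nonneg_right ?_ h0 <;> split_ifs
  exacts [hlt.le, le_rfl, le_rfl, hlt.le]

/-- If `a * x ≤ y ≤ b * x` with `a < b`, then `y` is `x` times a convex combination
of `a` and `b`. -/
theorem exists_convex_factor {a b x y : ℝ} (hab : a < b) (ha : a * x ≤ y) (hb : y ≤ b * x) :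
    ∃ l : ℝ, 0 ≤ l ∧ l ≤ 1 ∧ y = x * (l * b + (1 - l) * a) := by
  have hx : 0 ≤ x := by nlinarith
  rcases hx.eq_or_lt with rfl | hx
  · exact ⟨0, le_rfl, zero_le_one, by linarith⟩
  · have hpos : 0 < (b - a) * x := mul_pos (sub_pos.2 hab) hx
    refine ⟨(y - a * x) / ((b - a) * x), div_nonneg (by linarith) hpos.le,
      (div_le_one hpos).2 (by linarith), ?_⟩
    have hba : b - a ≠ 0 := (sub_pos.2 hab).ne'
    field_simp
    ring

theorem exists_nemGen_combination {n m : ℕ} (hm : 2 ≤ m) (hmn : m + 1 ≤ n) {x : ℕ → ℝ}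
    (hx2 : 0 ≤ x 2)
    (hx : ∀ i : ℕ, 2 ≤ i → i < m →
      (((n : ℝ) - i - 2) / ((n : ℝ) - i)) * x i ≤ x (i + 1) ∧
      x (i + 1) ≤ (((i : ℝ) + 1) / ((i : ℝ) - 1)) * x i) :
    ∃ c : Finset ℕ → ℝ, (∀ s, 0 ≤ c s) ∧
      ∀ i : ℕ, 2 ≤ i → i ≤ m →
        x i = ∑ s ∈ (Finset.Icc 3 m).powerset, c s * nemGen n s i := by
  induction m, hm using Nat.le_induction with
  | base =>
    refine ⟨fun _ => x 2, fun _ => hx2, fun i hi hi' => ?_⟩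
    obtain rfl : i = 2 := by omega
    simp [nemGen]
  | succ m hm ih =>
    obtain ⟨c, hc, hsum⟩ := ih (by omega) fun i hi him => hx i hi (by omega)
    obtain ⟨hlo, hhi⟩ := hx m hm (by omega)
    obtain ⟨l, hl0, hl1, hl⟩ :=
      exists_convex_factor (nem_lower_slope_lt_upper_slope hm (by omega)) hlo hhi
    refine ⟨fun s => (if m + 1 ∈ s then l else 1 - l) * c (s.erase (m + 1)),
      fun s => mul_nonneg (by split_ifs <;> linarith) (hc _), fun i hi him => ?_⟩
    have hnot : m + 1 ∉ Finset.Icc 3 m := by simp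
    rw [← Finset.insert_Icc_right_eq_Icc_add_one (by omega), Finset.sum_powerset_insert hnot,
      ← Finset.sum_add_distrib]
    rcases Nat.lt_or_ge m i with h | h
    · obtain rfl : i = m + 1 := by omega
      rw [hl, hsum m hm le_rfl, Finset.sum_mul]
      refine Finset.sum_congr rfl fun s hs => ?_
      have hms : m + 1 ∉ s := fun h => hnot (Finset.mem_powerset.1 hs h)
      have hins : nemGen n (insert (m + 1) s) m = nemGen n s m :=
        nemGen_congr n hm fun j hj => by simp [show j ≠ m + 1 by omega]
      rw [nemGen_succ n s hm, nemGen_succ n _ hm, hins]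
      simp only [hms, Finset.mem_insert_self, if_true, if_false, Finset.erase_insert hms,
        Finset.erase_eq_of_notMem hms]
      ring
    · rw [hsum i hi h]
      refine Finset.sum_congr rfl fun s hs => ?_
      have hms : m + 1 ∉ s := fun h => hnot (Finset.mem_powerset.1 hs h)
      have hins : nemGen n (insert (m + 1) s) i = nemGen n s i :=
        nemGen_congr n hi fun j hj => by simp [show j ≠ m + 1 by omega]
      simp only [hins, hms, Finset.mem_insert_self, if_true, if_false, Finset.erase_insert hms,
        Finset.erase_eq_of_notMem hms]
      ring

/-- the cone cut out by
`((n−i−2)/(n−i))·x_i ≤ x_{i+1} ≤ ((i+1)/(i−1))·x_i` (`2 ≤ i ≤ d−1`, `d = ⌊n/2⌋`)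
is exactly the set of nonnegative linear combinations of the `2^{d−2}` vectors `v_s`,
`s` ranging over the functions `{3,…,d} → {0,1}` (i.e. over subsets of `{3,…,d}`). -/
theorem nem_Xn0_generators (n : ℕ) (hn : 6 ≤ n) (x : ℕ → ℝ) :
    (∀ i : ℕ, 2 ≤ i → i ≤ n / 2 - 1 →
      (((n : ℝ) - i - 2) / ((n : ℝ) - i)) * x i ≤ x (i + 1) ∧
      x (i + 1) ≤ (((i : ℝ) + 1) / ((i : ℝ) - 1)) * x i)
    ↔ ∃ c : Finset ℕ → ℝ, (∀ s, 0 ≤ c s) ∧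
        ∀ i : ℕ, 2 ≤ i → i ≤ n / 2 →
          x i = ∑ s ∈ (Finset.Icc 3 (n / 2)).powerset, c s * nemGen n s i := by
  constructor
  · intro hx
    have hx2 : 0 ≤ x 2 := by
      have hlt := nem_lower_slope_lt_upper_slope (n := n) (le_refl 2) (by omega)
      obtain ⟨hlo, hhi⟩ := hx 2 le_rfl (by omega)
      nlinarith
    exact exists_nemGen_combination (by omega) (by omega) hx2
      fun i hi him => hx i hi (by omega)
  · rintro ⟨c, hc, hsum⟩ i hi hid
    rw [hsum i hi (by omega), hsum (i + 1) (by omega) (by omega), Finset.mul_sum, Finset.mul_sum]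
    constructor <;> refine Finset.sum_le_sum fun s _ => ?_ <;> rw [mul_left_comm]
    · exact mul_le_mul_of_nonneg_left (nemGen_slope_bounds s hi (by omega)).1 (hc s)
    · exact mul_le_mul_of_nonneg_left (nemGen_slope_bounds s hi (by omega)).2 (hc s)
end

section
/- Let l ≥ 3 be an integer. Let V be the real vector space with coordinates labeled x_i for 3 ≤ i ≤ l−1 and y_j for 2 ≤ j ≤ l−1 (so dim V = 2l−5). Let u_i (3 ≤ i ≤ l−1) and v_j (2 ≤ j ≤ l−1) be the corresponding standard unit vectors, and let u_2 ∈ V be the vector whose x_i-coordinate is −(l+1−i)(l−i)/((l−1)(l−2)) for each 3 ≤ i ≤ l−1 and whose y_j-coordinate is (j−1)(l−j)/((l−1)(l−2)) for each 2 ≤ j ≤ l−1. Then the set of nonnegative linear combinations of the 2l−4 vectors u_2, u_3, …, u_{l−1}, v_2, …, v_{l−1} is exactly the set of z ∈ V such that the y_j-coordinate of z is ≥ 0 for every 2 ≤ j ≤ l−1, and (j−1)(l−j)·(x_i-coordinate of z) + (l−i+1)(l−i)·(y_j-coordinate of z) ≥ 0 for all 3 ≤ i ≤ l−1 and 2 ≤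 j ≤ l−1. -/
lemma sum_smul_single_prod_eq {ι κ : Type*} [Fintype ι] [DecidableEq ι] [Fintype κ]
    [DecidableEq κ] (c : ι → ℝ) (d : κ → ℝ) (w : (ι → ℝ) × (κ → ℝ)) :
    w + (∑ i, c i • ((Pi.single i 1 : ι → ℝ), (0 : κ → ℝ)))
        + ∑ j, d j • ((0 : ι → ℝ), (Pi.single j 1 : κ → ℝ)) = w + (c, d) := by
  ext k <;> simp [Prod.fst_sum, Prod.snd_sum, Finset.sum_apply, Pi.single_apply]

/-- The cone generated by the standard unit vectors of `ℝ^ι × ℝ^κ` and the vector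
`(-p / N, q / N)`, with `p`, `q`, `N` positive, in terms of inequalities. -/
lemma exists_nonneg_combination_iff {ι κ : Type*} [Finite κ] [Nonempty κ]
    {p : ι → ℝ} {q : κ → ℝ} {N : ℝ} (hp : ∀ i, 0 < p i) (hq : ∀ j, 0 < q j) (hN : 0 < N)
    (z : (ι → ℝ) × (κ → ℝ)) :
    (∃ (a : ℝ) (c : ι → ℝ) (d : κ → ℝ), 0 ≤ a ∧ (∀ i, 0 ≤ c i) ∧ (∀ j, 0 ≤ d j) ∧
      z = a • ((fun i ↦ -p i / N), (fun j ↦ q j / N)) + (c, d)) ↔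
    (∀ j, 0 ≤ z.2 j) ∧ ∀ i j, 0 ≤ q j * z.1 i + p i * z.2 j := by
  constructor
  · rintro ⟨a, c, d, ha, hc, hd, rfl⟩
    refine ⟨fun j ↦ ?_, fun i j ↦ ?_⟩
    · have := hd j
      have := hq j
      simp only [Prod.snd_add, Prod.smul_snd, Pi.add_apply, Pi.smul_apply, smul_eq_mul]
      positivity
    · have h : 0 ≤ q j * c i + p i * d j :=
        add_nonneg (mul_nonneg (hq j).le (hc i)) (mul_nonneg (hp i).le (hd j))
      simp only [Prod.fst_add, Prod.smul_fst, Prod.snd_add, Prod.smul_snd, Pi.add_apply,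
        Pi.smul_apply, smul_eq_mul]
      convert h using 1
      ring
  · rintro ⟨hy, hxy⟩
    obtain ⟨k, hk⟩ := Finite.exists_min fun j ↦ z.2 j / q j
    refine ⟨z.2 k / q k * N, fun i ↦ z.1 i + z.2 k / q k * p i,
      fun j ↦ z.2 j - z.2 k / q k * q j, ?_, fun i ↦ ?_, fun j ↦ ?_, ?_⟩
    · exact mul_nonneg (div_nonneg (hy k) (hq k).le) hN.le
    · have hqk := hq k
      calc 0 ≤ (q k * z.1 i + p i * z.2 k) / q k := div_nonneg (hxy i k) hqk.le
        _ = z.1 i + z.2 k / q k * p i := by field_simp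
    · exact sub_nonneg.2 ((le_div_iff₀ (hq j)).1 (hk j))
    · have hqk := (hq k).ne'
      ext m
      · simp only [Prod.fst_add, Prod.smul_fst, Pi.add_apply, Pi.smul_apply, smul_eq_mul]
        field_simp
        ring
      · simp only [Prod.snd_add, Prod.smul_snd, Pi.add_apply, Pi.smul_apply, smul_eq_mul]
        field_simp
        ring


/-- Lemma `L:EffRn`: in the `(2l−5)`-dimensional space with
coordinates `x_i` (`3 ≤ i ≤ l−1`) and `y_j` (`2 ≤ j ≤ l−1`), the cone generated by
`u_2, u_3, …, u_{l−1}, v_2, …, v_{l−1}` (the standard unit vectors `u_i, v_j` and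
the vector `u_2` with `x_i`-coordinate `−(l+1−i)(l−i)/((l−1)(l−2))` and
`y_j`-coordinate `(j−1)(l−j)/((l−1)(l−2))`) equals the set of `z` with
`y_j(z) ≥ 0` for all `j` and `(j−1)(l−j)·x_i(z) + (l−i+1)(l−i)·y_j(z) ≥ 0` for all `i, j`. -/
theorem effcone_Xl1_2 (l : ℕ) (hl : 3 ≤ l)
    (u₂ : (↥(Finset.Icc 3 (l - 1)) → ℝ) × (↥(Finset.Icc 2 (l - 1)) → ℝ))
    (hu₂ : u₂ = ((fun i : ↥(Finset.Icc 3 (l - 1)) =>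
        -(((l : ℝ) + 1 - (i : ℕ)) * ((l : ℝ) - (i : ℕ))) / (((l : ℝ) - 1) * ((l : ℝ) - 2))),
      (fun j : ↥(Finset.Icc 2 (l - 1)) =>
        (((j : ℕ) : ℝ) - 1) * ((l : ℝ) - (j : ℕ)) / (((l : ℝ) - 1) * ((l : ℝ) - 2)))))
    (z : (↥(Finset.Icc 3 (l - 1)) → ℝ) × (↥(Finset.Icc 2 (l - 1)) → ℝ)) :
    (∃ (a : ℝ) (cu : ↥(Finset.Icc 3 (l - 1)) → ℝ) (cv : ↥(Finset.Icc 2 (l - 1)) → ℝ),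
      0 ≤ a ∧ (∀ i, 0 ≤ cu i) ∧ (∀ j, 0 ≤ cv j) ∧
      z = a • u₂
        + (∑ i, cu i • ((Pi.single i 1 : ↥(Finset.Icc 3 (l - 1)) → ℝ),
            (0 : ↥(Finset.Icc 2 (l - 1)) → ℝ)))
        + ∑ j, cv j • ((0 : ↥(Finset.Icc 3 (l - 1)) → ℝ),
            (Pi.single j 1 : ↥(Finset.Icc 2 (l - 1)) → ℝ)))
    ↔ ((∀ j, 0 ≤ z.2 j) ∧
       ∀ (i : ↥(Finset.Icc 3 (l - 1))) (j : ↥(Finset.Icc 2 (l - 1))),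
         0 ≤ (((j : ℕ) : ℝ) - 1) * ((l : ℝ) - (j : ℕ)) * z.1 i
           + ((l : ℝ) - (i : ℕ) + 1) * ((l : ℝ) - (i : ℕ)) * z.2 j) := by
  have hl' : (3 : ℝ) ≤ l := by exact_mod_cast hl
  have hκ : Nonempty ↥(Finset.Icc 2 (l - 1)) := ⟨⟨2, Finset.mem_Icc.2 ⟨le_rfl, by omega⟩⟩⟩
  have hp : ∀ i : ↥(Finset.Icc 3 (l - 1)),
      0 < ((l : ℝ) + 1 - (i : ℕ)) * ((l : ℝ) - (i : ℕ)) := by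
    rintro ⟨i, hi⟩
    have h : i < l := by grind
    have h' : (i : ℝ) < l := by exact_mod_cast h
    exact mul_pos (by dsimp only; linarith) (by dsimp only; linarith)
  have hq : ∀ j : ↥(Finset.Icc 2 (l - 1)),
      0 < (((j : ℕ) : ℝ) - 1) * ((l : ℝ) - (j : ℕ)) := by
    rintro ⟨j, hj⟩
    have h : 1 < j ∧ j < l := by grind
    have h₁ : (1 : ℝ) < j := by exact_mod_cast h.1
    have h₂ : (j : ℝ) < l := by exact_mod_cast h.2
    exact mul_pos (by dsimp only; linarith) (by dsimp only; linarith)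
  have hN : 0 < ((l : ℝ) - 1) * ((l : ℝ) - 2) := mul_pos (by linarith) (by linarith)
  subst hu₂
  simp only [sum_smul_single_prod_eq, sub_add_eq_add_sub]
  exact exists_nonneg_combination_iff hp hq hN z
end

section
/- Let n ≥ 5 be an integer and let y_2, …, y_{n−2} and z be real numbers such that: (i) (n−4)(n−3)·y_j + (j−1)(n−j−2)·z ≥ (n−4)(j−1)·y_{n−2} for all 2 ≤ j ≤ n−2; (ii) (n−4)(n−3)·y_j + (n−j−1)(j−2)·z ≥ (n−4)(n−j−1)·y_2 for all 2 ≤ j ≤ n−2; and (iii) y_2 + y_{n−2} ≥ z. Then y_j ≥ 0 for every j with 2 ≤ j ≤ n−2. -/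
/-- the key step of Proposition `P:effconeXn2`.  From the inequalities
(i) `(n−4)(n−3)·y_j + (j−1)(n−j−2)·z ≥ (n−4)(j−1)·y_{n−2}`,
(ii) `(n−4)(n−3)·y_j + (n−j−1)(j−2)·z ≥ (n−4)(n−j−1)·y_2` (for `2 ≤ j ≤ n−2`), and
(iii) `y_2 + y_{n−2} ≥ z`, it follows that `y_j ≥ 0` for all `2 ≤ j ≤ n−2`. -/
theorem effcone_Xn2_coords_nonneg (n : ℕ) (hn : 5 ≤ n) (y : ℕ → ℝ) (z : ℝ)
    (h1 : ∀ j : ℕ, 2 ≤ j → j ≤ n - 2 →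
      ((n : ℝ) - 4) * ((n : ℝ) - 3) * y j + ((j : ℝ) - 1) * ((n : ℝ) - j - 2) * z
        ≥ ((n : ℝ) - 4) * ((j : ℝ) - 1) * y (n - 2))
    (h2 : ∀ j : ℕ, 2 ≤ j → j ≤ n - 2 →
      ((n : ℝ) - 4) * ((n : ℝ) - 3) * y j + ((n : ℝ) - j - 1) * ((j : ℝ) - 2) * z
        ≥ ((n : ℝ) - 4) * ((n : ℝ) - j - 1) * y 2)
    (h3 : y 2 + y (n - 2) ≥ z) :
    ∀ j : ℕ, 2 ≤ j → j ≤ n - 2 → 0 ≤ y j := by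
  intro j hj hjn
  have hjn' : (j : ℝ) + 2 ≤ n := by exact_mod_cast (by omega : j + 2 ≤ n)
  have hj' : (2 : ℝ) ≤ j := by exact_mod_cast hj
  have hn' : (5 : ℝ) ≤ n := by exact_mod_cast hn
  have ha : 0 ≤ (j : ℝ) - 1 := by linarith
  have hb : 0 ≤ (n : ℝ) - j - 1 := by linarith
  have hc : 0 < (n : ℝ) - 4 := by linarith
  have hpos : 0 < ((n : ℝ) - 4) * (n - 3) * (n - 2) :=
    mul_pos (mul_pos hc (by linarith)) (by linarith)
  have e1 := mul_nonneg hb (sub_nonneg.2 (h1 j hj hjn))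
  have e2 := mul_nonneg ha (sub_nonneg.2 (h2 j hj hjn))
  have e3 := mul_nonneg (mul_nonneg (mul_nonneg hb ha) hc.le) (sub_nonneg.2 h3)
  refine nonneg_of_mul_nonneg_right ?_ hpos
  linear_combination e1 + e2 + e3
end

section
/- Let n ≥ 5 be an integer and let x_2, …, x_{n−2} be real numbers. Then the following are equivalent. (a) l·x_{n−l+1} ≥ (l−2)·x_{n−l} for all 3 ≤ l ≤ n−2, and (j−1)(l−j)·x_{n−l+1} + (l−1)(l−2)·x_j ≥ (j−1)(l−2)·x_l for all 3 ≤ l ≤ n−2 and 2 ≤ j ≤ l−1. (b) x_i ≥ 0 for all 2 ≤ i ≤ n−2; l·x_{n−l+1} ≥ (l−2)·x_{n−l} for all 3 ≤ l ≤ n−2; and (l−1)(j−1)(l−j)·x_{n−l+i−1} + (l−1)(l−i)(l−i+1)·x_j ≥ (j−1)(l−i)(l−i+1)·x_l for all 3 ≤ l ≤ n−2 and all 2 ≤ i ≤ l−1, 2 ≤ j ≤ l−1. -/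
/-- The inequalities at `l = (n + 1) / 2`, or at `l = n / 2` and `l = n / 2 + 1`, bound the first
coordinate below. -/
theorem nem_Xn1_two_nonneg {n : ℕ} (hn : 5 ≤ n) {x : ℕ → ℝ}
    (hI : ∀ l : ℕ, 3 ≤ l → l ≤ n - 2 →
      ((l : ℝ) - 2) * x (n - l + 1) + ((l : ℝ) - 1) * ((l : ℝ) - 2) * x 2
        ≥ ((l : ℝ) - 2) * x l) :
    0 ≤ x 2 := by
  have reduced (l : ℕ) (hl : 3 ≤ l) (hl' : l ≤ n - 2) :
      x l ≤ x (n - l + 1) + ((l : ℝ) - 1) * x 2 := by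
    have hl3 : (3 : ℝ) ≤ l := by exact_mod_cast hl
    refine le_of_mul_le_mul_left ?_ (show (0 : ℝ) < (l : ℝ) - 2 by linarith)
    linarith [hI l hl hl']
  obtain ⟨k, rfl | rfl⟩ := n.even_or_odd'
  · have h₁ := reduced k (by omega) (by omega)
    have h₂ := reduced (k + 1) (by omega) (by omega)
    rw [show 2 * k - k + 1 = k + 1 by omega] at h₁
    rw [show 2 * k - (k + 1) + 1 = k by omega] at h₂
    push_cast at h₂
    have hk : (3 : ℝ) ≤ k := by exact_mod_cast (show 3 ≤ k by omega)
    refine nonneg_of_mul_nonneg_right ?_ (show (0 : ℝ) < 2 * k - 1 by linarith)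
    linarith
  · have h := reduced (k + 1) (by omega) (by omega)
    rw [show 2 * k + 1 - (k + 1) + 1 = k + 1 by omega] at h
    push_cast at h
    have hk : (2 : ℝ) ≤ k := by exact_mod_cast (show 2 ≤ k by omega)
    refine nonneg_of_mul_nonneg_right ?_ (show (0 : ℝ) < k by linarith)
    linarith

/-- Corollary `C:NemXn1` and its proof: the reduced list of
inequalities (a) cutting out `Nem(X_{n,1})` is equivalent to the full list (b). -/
theorem nem_Xn1_inequalities_equiv (n : ℕ) (hn : 5 ≤ n) (x : ℕ → ℝ) :
    ((∀ l : ℕ, 3 ≤ l → l ≤ n - 2 →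
        (l : ℝ) * x (n - l + 1) ≥ ((l : ℝ) - 2) * x (n - l)) ∧
     (∀ l j : ℕ, 3 ≤ l → l ≤ n - 2 → 2 ≤ j → j ≤ l - 1 →
        ((j : ℝ) - 1) * ((l : ℝ) - j) * x (n - l + 1)
            + ((l : ℝ) - 1) * ((l : ℝ) - 2) * x j
          ≥ ((j : ℝ) - 1) * ((l : ℝ) - 2) * x l))
    ↔
    ((∀ i : ℕ, 2 ≤ i → i ≤ n - 2 → 0 ≤ x i) ∧
     (∀ l : ℕ, 3 ≤ l → l ≤ n - 2 →
        (l : ℝ) * x (n - l + 1) ≥ ((l : ℝ) - 2) * x (n - l)) ∧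
     (∀ l i j : ℕ, 3 ≤ l → l ≤ n - 2 → 2 ≤ i → i ≤ l - 1 → 2 ≤ j → j ≤ l - 1 →
        ((l : ℝ) - 1) * ((j : ℝ) - 1) * ((l : ℝ) - j) * x (n - l + i - 1)
            + ((l : ℝ) - 1) * ((l : ℝ) - i) * ((l : ℝ) - i + 1) * x j
          ≥ ((j : ℝ) - 1) * ((l : ℝ) - i) * ((l : ℝ) - i + 1) * x l)) := by
  constructor
  · rintro ⟨hJ, hI⟩
    refine ⟨fun i hi ↦ ?_, hJ, fun l i j hl hl' hi ↦ ?_⟩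
    · induction i, hi using Nat.le_induction with
      | base =>
        refine fun _ ↦ nem_Xn1_two_nonneg hn fun l hl hl' ↦ ?_
        have h := hI l 2 hl hl' le_rfl (by omega)
        push_cast at h
        linarith
      | succ m hm ih =>
        intro hm'
        have h := hJ (n - m) (by omega) (by omega)
        rw [show n - (n - m) = m by omega] at h
        have hd : (3 : ℝ) ≤ ((n - m : ℕ) : ℝ) := by
          exact_mod_cast (show 3 ≤ n - m by omega)
        refine nonneg_of_mul_nonneg_right (h.le.trans' ?_) (by linarith)
        exact mul_nonneg (by linarith) (ih (by omega))
    · induction i, hi using Nat.le_induction with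
      | base =>
        intro _ hj hj'
        have h := hI l j hl hl' hj hj'
        have hl3 : (3 : ℝ) ≤ l := by exact_mod_cast hl
        rw [show n - l + 2 - 1 = n - l + 1 by omega]
        push_cast
        linarith [mul_le_mul_of_nonneg_left h.le (show (0 : ℝ) ≤ (l : ℝ) - 1 by linarith)]
      | succ i hi ih =>
        intro hil hj hj'
        have h := ih (by omega) hj hj'
        have h' := hJ (l - i + 1) (by omega) (by omega)
        rw [show n - (l - i + 1) + 1 = n - l + i by omega,
          show n - (l - i + 1) = n - l + i - 1 by omega] at h'
        rw [show n - l + (i + 1) - 1 = n - l + i by omega]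
        push_cast [Nat.cast_sub (show i ≤ l by omega)] at h' ⊢
        have hl3 : (3 : ℝ) ≤ l := by exact_mod_cast hl
        have hj2 : (2 : ℝ) ≤ j := by exact_mod_cast hj
        have hjl : (j : ℝ) ≤ l := by exact_mod_cast (show j ≤ l by omega)
        have hil' : (i : ℝ) + 2 ≤ l := by exact_mod_cast (show i + 2 ≤ l by omega)
        have hA : 0 ≤ ((l : ℝ) - 1) * ((j : ℝ) - 1) * ((l : ℝ) - j) :=
          mul_nonneg (mul_nonneg (by linarith) (by linarith)) (by linarith)
        refine le_of_mul_le_mul_left ?_ (show (0 : ℝ) < (l : ℝ) - i + 1 by linarith)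
        linarith [mul_le_mul_of_nonneg_left h'.le hA,
          mul_le_mul_of_nonneg_left h.le (show (0 : ℝ) ≤ (l : ℝ) - i - 1 by linarith)]
  · rintro ⟨-, hJ, hI⟩
    refine ⟨hJ, fun l j hl hl' hj hj' ↦ ?_⟩
    have h := hI l 2 j hl hl' le_rfl (by omega) hj hj'
    have hl3 : (3 : ℝ) ≤ l := by exact_mod_cast hl
    rw [show n - l + 2 - 1 = n - l + 1 by omega] at h
    push_cast at h
    refine le_of_mul_le_mul_left ?_ (show (0 : ℝ) < (l : ℝ) - 1 by linarith)
    linarith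
end

section
/- Let n ≥ 5 be an integer and let x_2, …, x_{n−2} be real numbers satisfying l·x_{n−l+1} ≥ (l−2)·x_{n−l} for all 3 ≤ l ≤ n−2, and (j−1)(l−j)·x_{n−l+1} + (l−1)(l−2)·x_j ≥ (j−1)(l−2)·x_l for all 3 ≤ l ≤ n−2 and 2 ≤ j ≤ l−1. If x_j = 0 for some j with 3 ≤ j ≤ n−2, then x_i = 0 for all 2 ≤ i ≤ n−2. -/
/-- for an element of the cone `Nem(X_{n,1})` (cut out by the
inequalities of Corollary `C:NemXn1`), if some coordinate `x_j` with `3 ≤ j ≤ n−2`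
vanishes, then all coordinates vanish. -/
theorem nem_Xn1_zero_coord (n : ℕ) (hn : 5 ≤ n) (x : ℕ → ℝ)
    (hJ : ∀ l : ℕ, 3 ≤ l → l ≤ n - 2 →
      (l : ℝ) * x (n - l + 1) ≥ ((l : ℝ) - 2) * x (n - l))
    (hI : ∀ l j : ℕ, 3 ≤ l → l ≤ n - 2 → 2 ≤ j → j ≤ l - 1 →
      ((j : ℝ) - 1) * ((l : ℝ) - j) * x (n - l + 1)
          + ((l : ℝ) - 1) * ((l : ℝ) - 2) * x j
        ≥ ((j : ℝ) - 1) * ((l : ℝ) - 2) * x l)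
    (j : ℕ) (hj3 : 3 ≤ j) (hjn : j ≤ n - 2) (hxj : x j = 0) :
    ∀ i : ℕ, 2 ≤ i → i ≤ n - 2 → x i = 0 := by
  have hstep : ∀ m : ℕ, 2 ≤ m → m ≤ n - 3 →
      ((n : ℝ) - m - 2) * x m ≤ ((n : ℝ) - m) * x (m + 1) := by
    intro m hm hmn
    have h := hJ (n - m) (by omega) (by omega)
    rw [show n - (n - m) = m by omega, Nat.cast_sub (by omega)] at h
    exact h
  have hpos : ∀ m : ℕ, m ≤ n - 3 → 0 < (n : ℝ) - m - 2 := by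
    intro m hm
    have h : ((m + 3 : ℕ) : ℝ) ≤ n := by exact_mod_cast (by omega : m + 3 ≤ n)
    push_cast at h
    linarith
  have hrefl : ∀ l : ℕ, 3 ≤ l → l ≤ n - 2 → x l ≤ x (n - l + 1) + ((l : ℝ) - 1) * x 2 := by
    intro l hl hln
    have h := hI l 2 hl hln le_rfl (by omega)
    have hl' : (3 : ℝ) ≤ l := by exact_mod_cast hl
    push_cast at h
    refine le_of_mul_le_mul_left ?_ (by linarith : (0 : ℝ) < l - 2)
    linarith
  have hx2 : 0 ≤ x 2 := by
    have h1 := hrefl 3 le_rfl (by omega)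
    have h2 := hrefl (n - 2) (by omega) le_rfl
    rw [show n - 3 + 1 = n - 2 by omega] at h1
    rw [show n - (n - 2) + 1 = 3 by omega, Nat.cast_sub (by omega)] at h2
    push_cast at h1 h2
    have hn' : (5 : ℝ) ≤ n := by exact_mod_cast hn
    refine nonneg_of_mul_nonneg_right (?_ : 0 ≤ ((n : ℝ) - 1) * x 2) (by linarith)
    linarith
  have hnonneg : ∀ m : ℕ, 2 ≤ m → m ≤ n - 2 → 0 ≤ x m := by
    intro m hm
    induction m, hm using Nat.le_induction with
    | base => exact fun _ => hx2
    | succ m hm ih =>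
      intro hmn
      have hp := hpos m (by omega)
      have h := mul_nonneg hp.le (ih (by omega))
      exact nonneg_of_mul_nonneg_right (h.trans (hstep m hm (by omega))) (by linarith)
  have hdown : ∀ k : ℕ, 2 ≤ k → k ≤ n - 2 → x k = 0 → ∀ i : ℕ, 2 ≤ i → i ≤ k → x i = 0 := by
    intro k hk
    induction k, hk using Nat.le_induction with
    | base =>
      intro _ h i hi hi'
      rwa [le_antisymm hi' hi]
    | succ k hk ih =>
      intro hkn h i hi hi'
      have hxk : x k = 0 := by
        have hs := hstep k hk (by omega)
        rw [h, mul_zero] at hs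
        exact le_antisymm (nonpos_of_mul_nonpos_right hs (hpos k (by omega)))
          (hnonneg k hk (by omega))
      rcases Nat.le_succ_iff.mp hi' with hik | rfl
      · exact ih (by omega) hxk i hi hik
      · exact h
  have hlast : x (n - 2) = 0 := by
    have h := hrefl (n - 2) (by omega) le_rfl
    rw [show n - (n - 2) + 1 = 3 by omega, hdown j (by omega) hjn hxj 3 (by omega) hj3,
      hdown j (by omega) hjn hxj 2 le_rfl (by omega), mul_zero, add_zero] at h
    exact le_antisymm h (hnonneg _ (by omega) le_rfl)
  exact hdown (n - 2) (by omega) le_rfl hlast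
end

section
/- Let n ≥ 6 be an integer and let x_2, …, x_{n−2} be real numbers satisfying l·x_{n−l+1} ≥ (l−2)·x_{n−l} for all 3 ≤ l ≤ n−2, and (j−1)(l−j)·x_{n−l+1} + (l−1)(l−2)·x_j ≥ (j−1)(l−2)·x_l for all 3 ≤ l ≤ n−2 and 2 ≤ j ≤ l−1. If x_2 = 0, then x_{n−l+1} = x_l for all 3 ≤ l ≤ n−2, and ((n−l−2)/(n−l))·x_l ≤ x_{l+1} ≤ (l/(l−2))·x_l for all 3 ≤ l ≤ n−3. -/
/-- an element of the cone `Nem(X_{n,1})` with `x_2 = 0` is symmetric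
(`x_{n−l+1} = x_l` for `3 ≤ l ≤ n−2`) and satisfies the defining inequalities of
`Nem(X_{n−1,0})`: `((n−l−2)/(n−l))·x_l ≤ x_{l+1} ≤ (l/(l−2))·x_l` for `3 ≤ l ≤ n−3`. -/
theorem nem_Xn1_x2_zero (n : ℕ) (hn : 6 ≤ n) (x : ℕ → ℝ)
    (hJ : ∀ l : ℕ, 3 ≤ l → l ≤ n - 2 →
      (l : ℝ) * x (n - l + 1) ≥ ((l : ℝ) - 2) * x (n - l))
    (hI : ∀ l j : ℕ, 3 ≤ l → l ≤ n - 2 → 2 ≤ j → j ≤ l - 1 →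
      ((j : ℝ) - 1) * ((l : ℝ) - j) * x (n - l + 1)
          + ((l : ℝ) - 1) * ((l : ℝ) - 2) * x j
        ≥ ((j : ℝ) - 1) * ((l : ℝ) - 2) * x l)
    (hx2 : x 2 = 0) :
    (∀ l : ℕ, 3 ≤ l → l ≤ n - 2 → x (n - l + 1) = x l) ∧
    (∀ l : ℕ, 3 ≤ l → l ≤ n - 3 →
      (((n : ℝ) - l - 2) / ((n : ℝ) - l)) * x l ≤ x (l + 1) ∧
      x (l + 1) ≤ ((l : ℝ) / ((l : ℝ) - 2)) * x l) := by
  have hge : ∀ l : ℕ, 3 ≤ l → l ≤ n - 2 → x l ≤ x (n - l + 1) := by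
    intro l h3 hl
    have h := hI l 2 h3 hl le_rfl (by omega)
    have hl3 : (3 : ℝ) ≤ l := by exact_mod_cast h3
    rw [hx2] at h
    push_cast at h
    exact le_of_mul_le_mul_left (by linarith) (by linarith : (0 : ℝ) < (l : ℝ) - 2)
  have hsymm : ∀ l : ℕ, 3 ≤ l → l ≤ n - 2 → x (n - l + 1) = x l := by
    intro l h3 hl
    have h := hge (n - l + 1) (by omega) (by omega)
    rw [show n - (n - l + 1) + 1 = l by omega] at h
    exact le_antisymm h (hge l h3 hl)
  refine ⟨hsymm, fun l h3 hl => ⟨?_, ?_⟩⟩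
  · have h := hJ (n - l) (by omega) (by omega)
    rw [show n - (n - l) = l by omega, Nat.cast_sub (by omega : l ≤ n)] at h
    have hln : (0 : ℝ) < (n : ℝ) - l := by
      rw [sub_pos]
      exact_mod_cast (by omega : l < n)
    rw [div_mul_eq_mul_div, div_le_iff₀ hln]
    linarith
  · have h := hJ l h3 (by omega)
    have hl1 := hsymm (l + 1) (by omega) (by omega)
    rw [show n - (l + 1) + 1 = n - l by omega] at hl1
    rw [hsymm l h3 (by omega), hl1] at h
    have hl3 : (3 : ℝ) ≤ l := by exact_mod_cast h3
    rw [div_mul_eq_mul_div, le_div_iff₀ (by linarith)]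
    linarith
end

section
/- Let g ≥ 2 be an integer, let V be a real vector space, let d, ℓ ∈ V, and let δ_0, δ_1, …, δ_{g−1} ∈ V with δ_0 = 0. For 1 ≤ k ≤ 2g−1 define c_k ∈ V by: c_{2j+1} := 2(2g+1−2j)·d + (1/2)(2j+1−2g)·δ_j + (1/2)(g−j)·ℓ for 0 ≤ j ≤ g−1, and c_{2j} := 4(j−g)·d + (g+1−j)·δ_j for 1 ≤ j ≤ g−1. Define w_1 := 0 and w_{k+1} := (1/(2g+2−k))·(c_k + (2g−k)·w_k) for 1 ≤ k ≤ 2g−1. Then w_{2j} = 2·d + (j(g+1−j)/(4g+2))·ℓ for all 1 ≤ j ≤ g, and w_{2j+1} = (1/2)·δ_j + (j(g−j)/(4g+2))·ℓ for all 1 ≤ j ≤ g−1. -/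
/-- the induction establishing equations (E:images).  With `δ_0 = 0`,
`c_{2j+1} = 2(2g+1−2j)·d + (1/2)(2j+1−2g)·δ_j + (1/2)(g−j)·ℓ` (`0 ≤ j ≤ g−1`),
`c_{2j} = 4(j−g)·d + (g+1−j)·δ_j` (`1 ≤ j ≤ g−1`), `w_1 = 0`, and
`w_{k+1} = (1/(2g+2−k))·(c_k + (2g−k)·w_k)` (`1 ≤ k ≤ 2g−1`), one gets
`w_{2j} = 2·d + (j(g+1−j)/(4g+2))·ℓ` (`1 ≤ j ≤ g`) and
`w_{2j+1} = (1/2)·δ_j + (j(g−j)/(4g+2))·ℓ` (`1 ≤ j ≤ g−1`). -/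
theorem hyperelliptic_pushforward_recursion (g : ℕ) (hg : 2 ≤ g)
    (V : Type*) [AddCommGroup V] [Module ℝ V]
    (d ℓ : V) (δ : ℕ → V) (hδ0 : δ 0 = 0) (c w : ℕ → V)
    (hcodd : ∀ j : ℕ, j ≤ g - 1 →
      c (2 * j + 1) = (2 * (2 * (g : ℝ) + 1 - 2 * j)) • d
        + ((1 / 2) * (2 * (j : ℝ) + 1 - 2 * g)) • δ j
        + ((1 / 2) * ((g : ℝ) - j)) • ℓ)
    (hceven : ∀ j : ℕ, 1 ≤ j → j ≤ g - 1 →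
      c (2 * j) = (4 * ((j : ℝ) - g)) • d + ((g : ℝ) + 1 - j) • δ j)
    (hw1 : w 1 = 0)
    (hwrec : ∀ k : ℕ, 1 ≤ k → k ≤ 2 * g - 1 →
      w (k + 1) = (1 / (2 * (g : ℝ) + 2 - k)) • (c k + (2 * (g : ℝ) - k) • w k)) :
    (∀ j : ℕ, 1 ≤ j → j ≤ g →
      w (2 * j) = (2 : ℝ) • d
        + (((j : ℝ) * ((g : ℝ) + 1 - j)) / (4 * (g : ℝ) + 2)) • ℓ) ∧
    (∀ j : ℕ, 1 ≤ j → j ≤ g - 1 →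
      w (2 * j + 1) = (1 / 2 : ℝ) • δ j
        + (((j : ℝ) * ((g : ℝ) - j)) / (4 * (g : ℝ) + 2)) • ℓ) := by
  have hgpos : (4 * (g : ℝ) + 2) ≠ 0 := by positivity
  have even_of_odd (j : ℕ) (hj : j ≤ g - 1)
      (h : w (2 * j + 1) = (1 / 2 : ℝ) • δ j
        + (((j : ℝ) * ((g : ℝ) - j)) / (4 * (g : ℝ) + 2)) • ℓ) :
      w (2 * (j + 1)) = (2 : ℝ) • d
        + ((((j + 1 : ℕ) : ℝ) * ((g : ℝ) + 1 - (j + 1 : ℕ))) / (4 * (g : ℝ) + 2)) • ℓ := by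
    have hjg : (j : ℝ) + 1 ≤ g := by exact_mod_cast (by omega : j + 1 ≤ g)
    have hne : 2 * (g : ℝ) + 2 - (2 * j + 1) ≠ 0 := by linarith
    rw [show 2 * (j + 1) = 2 * j + 1 + 1 by ring, hwrec (2 * j + 1) (by omega) (by omega),
      hcodd j hj, h]
    push_cast
    rw [one_div, inv_smul_eq_iff₀ hne]
    match_scalars <;> field_simp <;> ring
  have odd_of_even (j : ℕ) (hj1 : 1 ≤ j) (hj : j ≤ g - 1)
      (h : w (2 * j) = (2 : ℝ) • d
        + (((j : ℝ) * ((g : ℝ) + 1 - j)) / (4 * (g : ℝ) + 2)) • ℓ) :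
      w (2 * j + 1) = (1 / 2 : ℝ) • δ j
        + (((j : ℝ) * ((g : ℝ) - j)) / (4 * (g : ℝ) + 2)) • ℓ := by
    have hjg : (j : ℝ) + 1 ≤ g := by exact_mod_cast (by omega : j + 1 ≤ g)
    have hne : 2 * (g : ℝ) + 2 - 2 * j ≠ 0 := by linarith
    rw [hwrec (2 * j) (by omega) (by omega), hceven j hj1 hj, h]
    push_cast
    rw [one_div, inv_smul_eq_iff₀ hne]
    match_scalars <;> field_simp
    ring
  have odd (j : ℕ) : j ≤ g - 1 → w (2 * j + 1) = (1 / 2 : ℝ) • δ j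
      + (((j : ℝ) * ((g : ℝ) - j)) / (4 * (g : ℝ) + 2)) • ℓ := by
    induction j with
    | zero => simp [hw1, hδ0]
    | succ j ih =>
      intro hj
      exact odd_of_even (j + 1) (by omega) hj (even_of_odd j (by omega) (ih (by omega)))
  refine ⟨fun j hj1 hj => ?_, fun j _ hj => odd j hj⟩
  obtain ⟨i, rfl⟩ := Nat.exists_eq_add_of_le' hj1
  exact even_of_odd i (by omega) (odd i (by omega))
end

section
/- Let n ≥ 2 be an integer, let V be a real vector space, let d, ℓ ∈ V, and let ε_0, ε_1, …, ε_{n−1} ∈ V. For 1 ≤ k ≤ 2n define c_k ∈ V by: c_1 := −(n−1)·ε_0; c_{2j+1} := −4(n−j)·d + (n+1−j)·ε_j for 1 ≤ j ≤ n−1; and c_{2j} := 2(2n+3−2j)·d − (1/2)(2n+1−2j)·ε_{j−1} + (1/2)(n+1−j)·ℓ for 1 ≤ j ≤ n. Define w_1 := 0 and w_{k+1} := (1/(2n+3−k))·(c_k + (2n+1−k)·w_k) for 1 ≤ k ≤ 2n. Then w_{2j+2} = (1/2)·ε_j + (j(n−j)/(2(2n+1)))·ℓ − ((n−j)(2n+1−2j)/((2n+1)(n+1)))·ε_0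 for all 0 ≤ j ≤ n−1, and w_{2j+1} = 2·d + (j(n+1−j)/(2(2n+1)))·ℓ − ((2n+1−2j)(n+1−j)/((2n+1)(n+1)))·ε_0 for all 1 ≤ j ≤ n. -/
/-- the induction establishing equations (E:maptoMg1).  With
`c_1 = −(n−1)·ε_0`, `c_{2j+1} = −4(n−j)·d + (n+1−j)·ε_j` (`1 ≤ j ≤ n−1`),
`c_{2j} = 2(2n+3−2j)·d − (1/2)(2n+1−2j)·ε_{j−1} + (1/2)(n+1−j)·ℓ` (`1 ≤ j ≤ n`),
`w_1 = 0`, and `w_{k+1} = (1/(2n+3−k))·(c_k + (2n+1−k)·w_k)` (`1 ≤ k ≤ 2n`), one gets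
`w_{2j+2} = (1/2)·ε_j + (j(n−j)/(2(2n+1)))·ℓ − ((n−j)(2n+1−2j)/((2n+1)(n+1)))·ε_0`
(`0 ≤ j ≤ n−1`) and
`w_{2j+1} = 2·d + (j(n+1−j)/(2(2n+1)))·ℓ − ((2n+1−2j)(n+1−j)/((2n+1)(n+1)))·ε_0`
(`1 ≤ j ≤ n`). -/
theorem weierstrass_pushforward_recursion (n : ℕ) (hn : 2 ≤ n)
    (V : Type*) [AddCommGroup V] [Module ℝ V]
    (d ℓ : V) (ε : ℕ → V) (c w : ℕ → V)
    (hc1 : c 1 = (-((n : ℝ) - 1)) • ε 0)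
    (hcodd : ∀ j : ℕ, 1 ≤ j → j ≤ n - 1 →
      c (2 * j + 1) = (-4 * ((n : ℝ) - j)) • d + ((n : ℝ) + 1 - j) • ε j)
    (hceven : ∀ j : ℕ, 1 ≤ j → j ≤ n →
      c (2 * j) = (2 * (2 * (n : ℝ) + 3 - 2 * j)) • d
        - ((1 / 2) * (2 * (n : ℝ) + 1 - 2 * j)) • ε (j - 1)
        + ((1 / 2) * ((n : ℝ) + 1 - j)) • ℓ)
    (hw1 : w 1 = 0)
    (hwrec : ∀ k : ℕ, 1 ≤ k → k ≤ 2 * n →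
      w (k + 1) = (1 / (2 * (n : ℝ) + 3 - k)) • (c k + (2 * (n : ℝ) + 1 - k) • w k)) :
    (∀ j : ℕ, j ≤ n - 1 →
      w (2 * j + 2) = (1 / 2 : ℝ) • ε j
        + (((j : ℝ) * ((n : ℝ) - j)) / (2 * (2 * (n : ℝ) + 1))) • ℓ
        - ((((n : ℝ) - j) * (2 * (n : ℝ) + 1 - 2 * j))
            / ((2 * (n : ℝ) + 1) * ((n : ℝ) + 1))) • ε 0) ∧
    (∀ j : ℕ, 1 ≤ j → j ≤ n →
      w (2 * j + 1) = (2 : ℝ) • d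
        + (((j : ℝ) * ((n : ℝ) + 1 - j)) / (2 * (2 * (n : ℝ) + 1))) • ℓ
        - (((2 * (n : ℝ) + 1 - 2 * j) * ((n : ℝ) + 1 - j))
            / ((2 * (n : ℝ) + 1) * ((n : ℝ) + 1))) • ε 0) := by
  have hn1 : (n : ℝ) + 1 ≠ 0 := by positivity
  have hn2 : 2 * (n : ℝ) + 1 ≠ 0 := by positivity
  have odd_of_even : ∀ j : ℕ, j + 1 ≤ n →
      w (2 * j + 2) = (1 / 2 : ℝ) • ε j
        + (((j : ℝ) * ((n : ℝ) - j)) / (2 * (2 * (n : ℝ) + 1))) • ℓ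
        - ((((n : ℝ) - j) * (2 * (n : ℝ) + 1 - 2 * j))
            / ((2 * (n : ℝ) + 1) * ((n : ℝ) + 1))) • ε 0 →
      w (2 * (j + 1) + 1) = (2 : ℝ) • d
        + ((((j + 1 : ℕ) : ℝ) * ((n : ℝ) + 1 - (j + 1 : ℕ))) / (2 * (2 * (n : ℝ) + 1))) • ℓ
        - (((2 * (n : ℝ) + 1 - 2 * (j + 1 : ℕ)) * ((n : ℝ) + 1 - (j + 1 : ℕ)))
            / ((2 * (n : ℝ) + 1) * ((n : ℝ) + 1))) • ε 0 := by
    intro j hj h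
    have hj' : (j : ℝ) + 1 ≤ n := by exact_mod_cast hj
    have hden : 2 * (n : ℝ) + 3 - 2 * (j + 1) ≠ 0 := by linarith
    rw [hwrec _ (by omega) (by omega), hceven _ (by omega) hj, Nat.add_sub_cancel,
      show 2 * (j + 1) = 2 * j + 2 by ring, h]
    push_cast
    rw [show 2 * (n : ℝ) + 3 - (2 * j + 2) = 2 * (n : ℝ) + 3 - 2 * (j + 1) by ring]
    generalize ε j = e
    generalize ε 0 = e₀
    match_scalars <;> field_simp <;> ring
  have even_of_odd : ∀ j : ℕ, 1 ≤ j → j + 1 ≤ n →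
      w (2 * j + 1) = (2 : ℝ) • d
        + (((j : ℝ) * ((n : ℝ) + 1 - j)) / (2 * (2 * (n : ℝ) + 1))) • ℓ
        - (((2 * (n : ℝ) + 1 - 2 * j) * ((n : ℝ) + 1 - j))
            / ((2 * (n : ℝ) + 1) * ((n : ℝ) + 1))) • ε 0 →
      w (2 * j + 2) = (1 / 2 : ℝ) • ε j
        + (((j : ℝ) * ((n : ℝ) - j)) / (2 * (2 * (n : ℝ) + 1))) • ℓ
        - ((((n : ℝ) - j) * (2 * (n : ℝ) + 1 - 2 * j))
            / ((2 * (n : ℝ) + 1) * ((n : ℝ) + 1))) • ε 0 := by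
    intro j hj1 hj h
    have hj' : (j : ℝ) + 1 ≤ n := by exact_mod_cast hj
    have hden : (n : ℝ) + 1 - j ≠ 0 := by linarith
    rw [hwrec (2 * j + 1) (by omega) (by omega), hcodd _ hj1 (by omega), h]
    push_cast
    rw [show 2 * (n : ℝ) + 3 - (2 * j + 1) = 2 * ((n : ℝ) + 1 - j) by ring]
    generalize ε j = e
    generalize ε 0 = e₀
    match_scalars <;> field_simp <;> ring
  have even : ∀ j : ℕ, j + 1 ≤ n →
      w (2 * j + 2) = (1 / 2 : ℝ) • ε j
        + (((j : ℝ) * ((n : ℝ) - j)) / (2 * (2 * (n : ℝ) + 1))) • ℓ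
        - ((((n : ℝ) - j) * (2 * (n : ℝ) + 1 - 2 * j))
            / ((2 * (n : ℝ) + 1) * ((n : ℝ) + 1))) • ε 0 := by
    intro j
    induction j with
    | zero =>
      intro _
      rw [show 2 * 0 + 2 = 1 + 1 from rfl, hwrec 1 le_rfl (by omega), hc1, hw1]
      push_cast
      rw [show 2 * (n : ℝ) + 3 - 1 = 2 * ((n : ℝ) + 1) by ring]
      match_scalars <;> field_simp <;> ring
    | succ j ih =>
      intro hj
      exact even_of_odd _ (by omega) hj (odd_of_even j (by omega) (ih (by omega)))
  refine ⟨fun j hj => even j (by omega), fun j hj1 hj => ?_⟩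
  obtain ⟨j, rfl⟩ := Nat.exists_eq_add_of_le' hj1
  exact odd_of_even j hj (even j hj)
end

section
/- Let g ≥ 2 be an integer, let u, v be real numbers, and let w_1, …, w_{g−1} be real numbers satisfying w_j = w_{g−j} for all 1 ≤ j ≤ g−1. Define real numbers x_2, …, x_{g+1} by x_{2j} := 2u + (j(g+1−j)/(4g+2))·v for 1 ≤ 2j ≤ g+1 and x_{2j+1} := (1/2)·w_j + (j(g−j)/(4g+2))·v for 3 ≤ 2j+1 ≤ g+1. Set n := 2g+2. Then the inequalities ((n−i−2)/(n−i))·x_i ≤ x_{i+1} ≤ ((i+1)/(i−1))·x_i hold for all 2 ≤ i ≤ g if and only if for all 1 ≤ i ≤ g−1 one has (2i−1)·w_i ≤ 4(2i+1)·u + i·v and 4i·u ≤ (i+1)·w_i. -/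
/-- The even-index inequalities, with the coefficients cleared. -/
theorem nem_even_iff {g j u v w : ℝ} (hj : 1 ≤ j) (hjg : 2 * j ≤ g) :
    (((2 * g + 2 - 2 * j - 2) / (2 * g + 2 - 2 * j)) *
        (2 * u + (j * (g + 1 - j)) / (4 * g + 2) * v) ≤
        (1 / 2) * w + (j * (g - j)) / (4 * g + 2) * v ∧
      (1 / 2) * w + (j * (g - j)) / (4 * g + 2) * v ≤
        ((2 * j + 1) / (2 * j - 1)) * (2 * u + (j * (g + 1 - j)) / (4 * g + 2) * v)) ↔
    ((2 * j - 1) * w ≤ 4 * (2 * j + 1) * u + j * v ∧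
      4 * (g - j) * u ≤ (g - j + 1) * w) := by
  have hc : 0 < 4 * g + 2 := by linarith
  have hd : 0 < 2 * g + 2 - 2 * j := by linarith
  have he : 0 < 2 * j - 1 := by linarith
  obtain ⟨t, rfl⟩ : ∃ t, v = (4 * g + 2) * t := ⟨v / (4 * g + 2), by field_simp⟩
  have cancel (a : ℝ) : a / (4 * g + 2) * ((4 * g + 2) * t) = a * t := by field_simp
  rw [cancel, cancel, div_mul_eq_mul_div, div_mul_eq_mul_div (2 * j + 1), div_le_iff₀ hd, le_div_iff₀ he,
    and_comm]
  refine and_congr ⟨fun h => ?_, fun h => ?_⟩ ⟨fun h => ?_, fun h => ?_⟩ <;> linarith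

/-- The odd-index inequalities, with the coefficients cleared. -/
theorem nem_odd_iff {g j u v w : ℝ} (hj : 1 ≤ j) (hjg : 2 * j + 1 ≤ g) :
    (((2 * g + 2 - (2 * j + 1) - 2) / (2 * g + 2 - (2 * j + 1))) *
        ((1 / 2) * w + (j * (g - j)) / (4 * g + 2) * v) ≤
        2 * u + ((j + 1) * (g + 1 - (j + 1))) / (4 * g + 2) * v ∧
      2 * u + ((j + 1) * (g + 1 - (j + 1))) / (4 * g + 2) * v ≤
        ((2 * j + 1 + 1) / (2 * j + 1 - 1)) *
          ((1 / 2) * w + (j * (g - j)) / (4 * g + 2) * v)) ↔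
    ((2 * (g - j) - 1) * w ≤ 4 * (2 * (g - j) + 1) * u + (g - j) * v ∧
      4 * j * u ≤ (j + 1) * w) := by
  have hc : 0 < 4 * g + 2 := by linarith
  have hd : 0 < 2 * g + 2 - (2 * j + 1) := by linarith
  have he : 0 < 2 * j + 1 - 1 := by linarith
  obtain ⟨t, rfl⟩ : ∃ t, v = (4 * g + 2) * t := ⟨v / (4 * g + 2), by field_simp⟩
  have cancel (a : ℝ) : a / (4 * g + 2) * ((4 * g + 2) * t) = a * t := by field_simp
  rw [cancel, cancel, div_mul_eq_mul_div, div_mul_eq_mul_div (2 * j + 1 + 1), div_le_iff₀ hd,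
    le_div_iff₀ he]
  refine and_congr ⟨fun h => ?_, fun h => ?_⟩ ⟨fun h => ?_, fun h => ?_⟩ <;> linarith

/-- Corollary of §8.1: with `n = 2g+2`,
`x_{2j} = 2u + (j(g+1−j)/(4g+2))·v` and `x_{2j+1} = (1/2)·w_j + (j(g−j)/(4g+2))·v`,
and `w_j = w_{g−j}`, the inequalities
`((n−i−2)/(n−i))·x_i ≤ x_{i+1} ≤ ((i+1)/(i−1))·x_i` hold for all `2 ≤ i ≤ g` iff
`(2i−1)·w_i ≤ 4(2i+1)·u + i·v` and `4i·u ≤ (i+1)·w_i` hold for all `1 ≤ i ≤ g−1`. -/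
theorem effective_pullback_nem_hyperelliptic (g : ℕ) (hg : 2 ≤ g) (u v : ℝ)
    (w : ℕ → ℝ) (hsym : ∀ j : ℕ, 1 ≤ j → j ≤ g - 1 → w j = w (g - j))
    (x : ℕ → ℝ)
    (hxe : ∀ j : ℕ, 1 ≤ 2 * j → 2 * j ≤ g + 1 →
      x (2 * j) = 2 * u + ((j : ℝ) * ((g : ℝ) + 1 - j)) / (4 * (g : ℝ) + 2) * v)
    (hxo : ∀ j : ℕ, 3 ≤ 2 * j + 1 → 2 * j + 1 ≤ g + 1 →
      x (2 * j + 1) = (1 / 2) * w j + ((j : ℝ) * ((g : ℝ) - j)) / (4 * (g : ℝ) + 2) * v) :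
    (∀ i : ℕ, 2 ≤ i → i ≤ g →
      ((2 * (g : ℝ) + 2 - i - 2) / (2 * (g : ℝ) + 2 - i)) * x i ≤ x (i + 1) ∧
      x (i + 1) ≤ (((i : ℝ) + 1) / ((i : ℝ) - 1)) * x i)
    ↔ (∀ i : ℕ, 1 ≤ i → i ≤ g - 1 →
      (2 * (i : ℝ) - 1) * w i ≤ 4 * (2 * (i : ℝ) + 1) * u + (i : ℝ) * v ∧
      4 * (i : ℝ) * u ≤ ((i : ℝ) + 1) * w i) := by
  have even_iff (j : ℕ) (h1 : 1 ≤ j) (h2 : 2 * j ≤ g) :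
      (((2 * (g : ℝ) + 2 - (2 * j : ℕ) - 2) / (2 * (g : ℝ) + 2 - (2 * j : ℕ))) * x (2 * j) ≤
          x (2 * j + 1) ∧
        x (2 * j + 1) ≤ ((((2 * j : ℕ) : ℝ) + 1) / (((2 * j : ℕ) : ℝ) - 1)) * x (2 * j)) ↔
      ((2 * (j : ℝ) - 1) * w j ≤ 4 * (2 * (j : ℝ) + 1) * u + j * v ∧
        4 * ((g - j : ℕ) : ℝ) * u ≤ (((g - j : ℕ) : ℝ) + 1) * w (g - j)) := by
    rw [hxe j (by omega) (by omega), hxo j (by omega) (by omega), ← hsym j h1 (by omega),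
      Nat.cast_sub (by omega : j ≤ g)]
    push_cast
    exact nem_even_iff (by exact_mod_cast h1) (by exact_mod_cast h2)
  have odd_iff (j : ℕ) (h1 : 1 ≤ j) (h2 : 2 * j + 1 ≤ g) :
      (((2 * (g : ℝ) + 2 - (2 * j + 1 : ℕ) - 2) / (2 * (g : ℝ) + 2 - (2 * j + 1 : ℕ))) *
          x (2 * j + 1) ≤ x (2 * j + 1 + 1) ∧
        x (2 * j + 1 + 1) ≤
          ((((2 * j + 1 : ℕ) : ℝ) + 1) / (((2 * j + 1 : ℕ) : ℝ) - 1)) * x (2 * j + 1)) ↔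
      ((2 * ((g - j : ℕ) : ℝ) - 1) * w (g - j) ≤
          4 * (2 * ((g - j : ℕ) : ℝ) + 1) * u + ((g - j : ℕ) : ℝ) * v ∧
        4 * (j : ℝ) * u ≤ ((j : ℝ) + 1) * w j) := by
    rw [show 2 * j + 1 + 1 = 2 * (j + 1) by ring, hxe (j + 1) (by omega) (by omega),
      hxo j (by omega) (by omega), ← hsym j h1 (by omega), Nat.cast_sub (by omega : j ≤ g)]
    push_cast
    exact nem_odd_iff (by exact_mod_cast h1) (by exact_mod_cast h2)
  constructor
  · intro h i h1 h2
    have hi : g - (g - i) = i := by omega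
    constructor
    · by_cases hig : 2 * i ≤ g
      · exact ((even_iff i h1 hig).1 (h (2 * i) (by omega) hig)).1
      · have hodd := (odd_iff (g - i) (by omega) (by omega)).1 (h _ (by omega) (by omega))
        simpa only [hi] using hodd.1
    · by_cases hig : 2 * i + 1 ≤ g
      · exact ((odd_iff i h1 hig).1 (h (2 * i + 1) (by omega) hig)).2
      · have heven := (even_iff (g - i) (by omega) (by omega)).1 (h _ (by omega) (by omega))
        simpa only [hi] using heven.2
  · intro h i h1 h2
    obtain ⟨j, rfl | rfl⟩ := i.even_or_odd'
    · exact (even_iff j (by omega) h2).2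
        ⟨(h j (by omega) (by omega)).1, (h (g - j) (by omega) (by omega)).2⟩
    · exact (odd_iff j (by omega) h2).2
        ⟨(h (g - j) (by omega) (by omega)).1, (h j (by omega) (by omega)).2⟩
end

section
/- Let n ≥ 2 be an integer and let u, v, a, b be real numbers such that 2a ≥ 4u, 12u + v ≥ a, n·b ≥ 4(n−1)·u, and 4(2n−1)·u + (n−1)·v ≥ (2n−3)·b. Then for all integers k, m with 1 ≤ k ≤ n−1 and 0 ≤ m ≤ k−1, one has 4(2(k+m)+3)·u + (k+1)(m+1)·v ≥ 0. -/
/-- the arithmetic reduction in the proof of Corollary `C:Mg1ineqs`.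
From `2a ≥ 4u`, `12u + v ≥ a`, `n·b ≥ 4(n−1)·u`, and
`4(2n−1)·u + (n−1)·v ≥ (2n−3)·b`, it follows that
`4(2(k+m)+3)·u + (k+1)(m+1)·v ≥ 0` for all `1 ≤ k ≤ n−1` and `0 ≤ m ≤ k−1`. -/
theorem mg1_arithmetic_reduction (n : ℕ) (hn : 2 ≤ n) (u v a b : ℝ)
    (h1 : 2 * a ≥ 4 * u) (h2 : 12 * u + v ≥ a)
    (h3 : (n : ℝ) * b ≥ 4 * ((n : ℝ) - 1) * u)
    (h4 : 4 * (2 * (n : ℝ) - 1) * u + ((n : ℝ) - 1) * v ≥ (2 * (n : ℝ) - 3) * b) :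
    ∀ k m : ℕ, 1 ≤ k → k ≤ n - 1 → m ≤ k - 1 →
      0 ≤ 4 * (2 * ((k : ℝ) + m) + 3) * u + ((k : ℝ) + 1) * ((m : ℝ) + 1) * v := by
  intro k m hk hkn hmk
  have hN : (2 : ℝ) ≤ n := by exact_mod_cast hn
  have hM : (0 : ℝ) ≤ m := m.cast_nonneg
  have hKN : (k : ℝ) + 1 ≤ n := by
    have : k + 1 ≤ n := by omega
    exact_mod_cast this
  have hMK : (m : ℝ) + 1 ≤ k := by
    have : m + 1 ≤ k := by omega
    exact_mod_cast this
  generalize (n : ℝ) = N at *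
  generalize (k : ℝ) = K at *
  generalize (m : ℝ) = M at *
  have hxy : 0 ≤ (K + 1) * (M + 1) := mul_nonneg (by linarith) (by linarith)
  rcases le_total 0 u with hu | hu
  · have hB : 0 ≤ 4 * (4 * N - 3) * u + N * (N - 1) * v := by
      have e1 := mul_le_mul_of_nonneg_left h3 (show 0 ≤ 2 * N - 3 by linarith)
      have e2 := mul_le_mul_of_nonneg_left h4 (show 0 ≤ N by linarith)
      linarith
    have hc : 0 ≤ N * (N - 1) * (2 * (K + M) + 3) - (4 * N - 3) * ((K + 1) * (M + 1)) := by
      have e1 : 0 ≤ (N - (K + 1)) * ((N - 1) * (2 * M + 1)) :=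
        mul_nonneg (by linarith) (mul_nonneg (by linarith) (by linarith))
      have e2 : 0 ≤ (K + 1) * ((2 * N - 1) * (N - 2 - M)) :=
        mul_nonneg (by linarith) (mul_nonneg (by linarith) (by linarith))
      linarith
    have hNN : 0 < N * (N - 1) := mul_pos (by linarith) (by linarith)
    refine nonneg_of_mul_nonneg_right ?_ hNN
    have e1 := mul_nonneg hxy hB
    have e2 := mul_nonneg hc hu
    linarith
  · have hA : 0 ≤ 10 * u + v := by linarith
    have hc : 0 ≤ 10 * ((K + 1) * (M + 1)) - 4 * (2 * (K + M) + 3) := by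
      nlinarith [mul_nonneg hM (show 0 ≤ K - 1 by linarith)]
    have e1 := mul_nonneg hxy hA
    have e2 := mul_nonneg hc (neg_nonneg.mpr hu)
    linarith
end

section
/- In ℝ³ with coordinates (x_2, x_3, x_4), the set of points satisfying the five inequalities 3x_4 ≥ x_3, 2x_3 ≥ x_2, x_4 + 2x_2 ≥ x_3, x_3 + 3x_2 ≥ x_4, and 2x_3 ≥ x_4 is exactly the set of nonnegative linear combinations of the five vectors (6,3,1), (1,3,1), (0,1,1), (1,3,6), and (2,1,2). -/
/-- `Nem(X_{6,1})` in coordinates `(x_2, x_3, x_4)` (here `x 0, x 1, x 2`):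
the points satisfying `3x_4 ≥ x_3`, `2x_3 ≥ x_2`, `x_4 + 2x_2 ≥ x_3`,
`x_3 + 3x_2 ≥ x_4`, `2x_3 ≥ x_4` are exactly the nonnegative combinations of
`(6,3,1)`, `(1,3,1)`, `(0,1,1)`, `(1,3,6)`, `(2,1,2)`. -/
theorem nem_X61 (x : Fin 3 → ℝ) :
    (3 * x 2 ≥ x 1 ∧ 2 * x 1 ≥ x 0 ∧ x 2 + 2 * x 0 ≥ x 1 ∧
      x 1 + 3 * x 0 ≥ x 2 ∧ 2 * x 1 ≥ x 2)
    ↔ ∃ c : Fin 5 → ℝ, (∀ i, 0 ≤ c i) ∧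
        x = ∑ i, c i • ![![(6 : ℝ), 3, 1], ![1, 3, 1], ![0, 1, 1], ![1, 3, 6], ![2, 1, 2]] i := by
  constructor
  · rintro ⟨h₁, h₂, h₃, h₄, h₅⟩
    rcases le_total (x 2) (x 0) with h | h
    · refine ⟨![(x 0 - x 2) / 5, (2 * x 1 - x 0) / 5, 0, 0, (3 * x 2 - x 1) / 5], ?_, ?_⟩
      · intro i
        fin_cases i <;> simp <;> linarith
      · ext j
        fin_cases j <;> simp [Fin.sum_univ_five] <;> ring
    · rcases le_total (2 * x 2) (x 0 + 2 * x 1) with h' | h'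
      · refine ⟨![0, (x 0 + 2 * x 1 - 2 * x 2) / 5, x 2 - x 0, 0,
          (x 2 + 2 * x 0 - x 1) / 5], ?_, ?_⟩
        · intro i
          fin_cases i <;> simp <;> linarith
        · ext j
          fin_cases j <;> simp [Fin.sum_univ_five] <;> ring
      · refine ⟨![0, 0, 2 * x 1 - x 2, (2 * x 2 - x 0 - 2 * x 1) / 5,
          (x 1 + 3 * x 0 - x 2) / 5], ?_, ?_⟩
        · intro i
          fin_cases i <;> simp <;> linarith
        · ext j
          fin_cases j <;> simp [Fin.sum_univ_five] <;> ring
  · rintro ⟨c, hc, rfl⟩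
    have h0 := hc 0
    have h1 := hc 1
    have h2 := hc 2
    have h3 := hc 3
    have h4 := hc 4
    simp only [Finset.sum_apply, Pi.smul_apply, smul_eq_mul, Fin.sum_univ_five]
    simp
    refine ⟨?_, ?_, ?_, ?_, ?_⟩ <;> linarith
end
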